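/- arXiv:2408.04510 — 7 statements merged into one kernel-verified Lean document; each statement's English description precedes it below -/
import Mathlib

section
/- The group presented by five generators a, b, x₁, x₂, x₃ subject to the relators x₁x₂⁻¹, x₂x₃⁻¹, x₃x₁⁻¹, b⁻¹x₁x₂x₃b, and a⁻¹x₁⁻¹x₂⁻¹x₃⁻¹a is isomorphic to the free product of the free group on two generators with the cyclic group ℤ/3ℤ. -/
open FreeGroup

/-- The homomorphism out of `ℤ/3ℤ` given by an element whose cube is trivial. -/
def trefoilZ3Hom {G : Type*} [Group G] (g : G) (hg : g ^ 3 = 1) :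
    Multiplicative (ZMod 3) →* G where
  toFun z := g ^ (Multiplicative.toAdd z).val
  map_one' := by simp
  map_mul' x y := by
    rw [toAdd_mul, ZMod.val_add, ← pow_add, ← pow_eq_pow_mod _ hg]

theorem trefoilZ3Hom_one {G : Type*} [Group G] (g : G) (hg : g ^ 3 = 1) :
    trefoilZ3Hom g hg (Multiplicative.ofAdd 1) = g := by
  change g ^ 1 = g
  simp

theorem trefoilZ3_ext {G : Type*} [Group G] (f g : Multiplicative (ZMod 3) →* G)
    (h : f (Multiplicative.ofAdd 1) = g (Multiplicative.ofAdd 1)) : f = g := by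
  refine MonoidHom.ext fun z => ?_
  have : ∀ z : Multiplicative (ZMod 3), ∃ k : Fin 3, z = (Multiplicative.ofAdd 1) ^ k.val := by
    decide
  obtain ⟨k, rfl⟩ := this z
  rw [_root_.map_pow, _root_.map_pow, h]

/-- The electric group of the trefoil: the group presented by five generators
`a, b, x₁, x₂, x₃` (encoded as `0, 1, 2, 3, 4 : Fin 5`) subject to the relators
`x₁x₂⁻¹`, `x₂x₃⁻¹`, `x₃x₁⁻¹`, `b⁻¹x₁x₂x₃b`, `a⁻¹x₁⁻¹x₂⁻¹x₃⁻¹a` is isomorphic to the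
free product (coproduct of groups) of the free group on two generators with `ℤ/3ℤ`
(written multiplicatively). -/
theorem electric_group_trefoil_free_product :
    Nonempty
      (PresentedGroup
          ({of 2 * (of 3)⁻¹, of 3 * (of 4)⁻¹, of 4 * (of 2)⁻¹,
            (of 1)⁻¹ * of 2 * of 3 * of 4 * of 1,
            (of 0)⁻¹ * (of 2)⁻¹ * (of 3)⁻¹ * (of 4)⁻¹ * of 0} : Set (FreeGroup (Fin 5))) ≃*
        Monoid.Coprod (FreeGroup (Fin 2)) (Multiplicative (ZMod 3))) := by
  generalize hR : ({of 2 * (of 3)⁻¹, of 3 * (of 4)⁻¹, of 4 * (of 2)⁻¹,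
            (of 1)⁻¹ * of 2 * of 3 * of 4 * of 1,
            (of 0)⁻¹ * (of 2)⁻¹ * (of 3)⁻¹ * (of 4)⁻¹ * of 0} : Set (FreeGroup (Fin 5))) = R
  let p : Fin 5 → PresentedGroup R := PresentedGroup.of
  have e23 : p 2 = p 3 := by
    have : PresentedGroup.mk R (of 2 * (of 3)⁻¹) = 1 :=
      PresentedGroup.one_of_mem (by rw [← hR]; simp)
    rw [_root_.map_mul, _root_.map_inv] at this
    exact mul_inv_eq_one.mp this
  have e34 : p 3 = p 4 := by
    have : PresentedGroup.mk R (of 3 * (of 4)⁻¹) = 1 :=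
      PresentedGroup.one_of_mem (by rw [← hR]; simp)
    rw [_root_.map_mul, _root_.map_inv] at this
    exact mul_inv_eq_one.mp this
  have e3 : p 2 ^ 3 = 1 := by
    have : PresentedGroup.mk R ((of 1)⁻¹ * of 2 * of 3 * of 4 * of 1) = 1 :=
      PresentedGroup.one_of_mem (by rw [← hR]; simp)
    simp only [_root_.map_mul, _root_.map_inv] at this
    change (p 1)⁻¹ * p 2 * p 3 * p 4 * p 1 = 1 at this
    rw [← e34, ← e23] at this
    have h2 : p 2 ^ 3 = p 1 * ((p 1)⁻¹ * p 2 * p 2 * p 2 * p 1) * (p 1)⁻¹ := by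
      simp [pow_succ, mul_assoc]
    rw [h2, this]; group
  let t : Monoid.Coprod (FreeGroup (Fin 2)) (Multiplicative (ZMod 3)) :=
    Monoid.Coprod.inr (Multiplicative.ofAdd 1)
  have ht : t * t * t = 1 := by
    change Monoid.Coprod.inr _ * Monoid.Coprod.inr _ * Monoid.Coprod.inr _ = _
    rw [← _root_.map_mul, ← _root_.map_mul]
    exact _root_.map_one _
  let f : Fin 5 → Monoid.Coprod (FreeGroup (Fin 2)) (Multiplicative (ZMod 3)) :=
    ![Monoid.Coprod.inl (of 0), Monoid.Coprod.inl (of 1), t, t, t]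
  have hf : ∀ r ∈ R, FreeGroup.lift f r = 1 := by
    have ht' : t⁻¹ * t⁻¹ * t⁻¹ = 1 := by
      rw [← inv_one, ← ht]; group
    have f0 : f 0 = Monoid.Coprod.inl (of 0) := rfl
    have f1 : f 1 = Monoid.Coprod.inl (of 1) := rfl
    have f2 : f 2 = t := rfl
    have f3 : f 3 = t := rfl
    have f4 : f 4 = t := rfl
    rw [← hR]
    rintro r (rfl | rfl | rfl | rfl | rfl) <;>
      simp only [_root_.map_mul, _root_.map_inv, FreeGroup.lift_apply_of, f0, f1, f2, f3, f4]
    · group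
    · group
    · group
    · rw [mul_assoc (_⁻¹) t, mul_assoc (_⁻¹) (t * t), ht]; group
    · rw [mul_assoc (_⁻¹) t⁻¹, mul_assoc (_⁻¹) (t⁻¹ * t⁻¹), ht']; group
  let F := PresentedGroup.toGroup hf
  let G : Monoid.Coprod (FreeGroup (Fin 2)) (Multiplicative (ZMod 3)) →* PresentedGroup R :=
    Monoid.Coprod.lift (FreeGroup.lift ![p 0, p 1]) (trefoilZ3Hom (p 2) e3)
  have Fp : ∀ i, F (p i) = f i := fun i => PresentedGroup.toGroup.of hf
  have Gt : G t = p 2 := by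
    change Monoid.Coprod.lift _ _ (Monoid.Coprod.inr _) = _
    rw [Monoid.Coprod.lift_apply_inr, trefoilZ3Hom_one]
  have Gl : ∀ i, G (Monoid.Coprod.inl (of i)) = ![p 0, p 1] i := fun i => by
    change Monoid.Coprod.lift _ _ (Monoid.Coprod.inl _) = _
    rw [Monoid.Coprod.lift_apply_inl, FreeGroup.lift_apply_of]
  refine ⟨MonoidHom.toMulEquiv F G ?_ ?_⟩
  · apply PresentedGroup.ext
    intro i
    change G (F (p i)) = p i
    rw [Fp]
    fin_cases i
    · exact Gl 0
    · exact Gl 1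
    · exact Gt
    · exact Gt.trans e23
    · exact Gt.trans (e23.trans e34)
  · apply Monoid.Coprod.hom_ext
    · apply FreeGroup.ext_hom
      intro i
      change F (G (Monoid.Coprod.inl (of i))) = Monoid.Coprod.inl (of i)
      rw [Gl]
      fin_cases i
      · exact Fp 0
      · exact Fp 1
    · apply trefoilZ3_ext
      change F (G t) = t
      rw [Gt]
      exact Fp 2
end

section
/- The group presented by three generators x₁, x₂, x₃ subject to the relators x₁x₂⁻¹, x₂x₃⁻¹, x₃x₁⁻¹, x₁x₂x₃, and x₁⁻¹x₃⁻¹x₂⁻¹ is isomorphic to the cyclic group ℤ/3ℤ. -/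
open FreeGroup

/-- The reduced electric group of the trefoil: the group presented by three generators
`x₁, x₂, x₃` (encoded as `0, 1, 2 : Fin 3`) subject to the relators
`x₁x₂⁻¹`, `x₂x₃⁻¹`, `x₃x₁⁻¹`, `x₁x₂x₃`, `x₁⁻¹x₃⁻¹x₂⁻¹` is isomorphic to the cyclic
group `ℤ/3ℤ` (written multiplicatively). -/
theorem reduced_electric_group_trefoil :
    Nonempty
      (PresentedGroup
          ({of 0 * (of 1)⁻¹, of 1 * (of 2)⁻¹, of 2 * (of 0)⁻¹,
            of 0 * of 1 * of 2,
            (of 0)⁻¹ * (of 2)⁻¹ * (of 1)⁻¹} : Set (FreeGroup (Fin 3))) ≃*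
        Multiplicative (ZMod 3)) := by
  generalize hR : ({of 0 * (of 1)⁻¹, of 1 * (of 2)⁻¹, of 2 * (of 0)⁻¹,
            of 0 * of 1 * of 2,
            (of 0)⁻¹ * (of 2)⁻¹ * (of 1)⁻¹} : Set (FreeGroup (Fin 3))) = R
  have hf : ∀ r ∈ R, FreeGroup.lift
      (fun _ : Fin 3 => (Multiplicative.ofAdd (1 : ZMod 3))) r = 1 := by
    intro r hr
    rw [← hR] at hr
    simp only [Set.mem_insert_iff, Set.mem_singleton_iff] at hr
    rcases hr with rfl | rfl | rfl | rfl | rfl <;>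
      simp only [_root_.map_mul, _root_.map_inv, FreeGroup.lift_apply_of] <;> decide
  have h01 : PresentedGroup.mk R (of 0 * (of 1)⁻¹) = 1 :=
    PresentedGroup.one_of_mem (by rw [← hR]; simp)
  have h12 : PresentedGroup.mk R (of 1 * (of 2)⁻¹) = 1 :=
    PresentedGroup.one_of_mem (by rw [← hR]; simp)
  have h012 : PresentedGroup.mk R (of 0 * of 1 * of 2) = 1 :=
    PresentedGroup.one_of_mem (by rw [← hR]; simp)
  simp only [_root_.map_mul, _root_.map_inv, mul_inv_eq_one] at h01 h12 h012
  have hx : ∀ i, (PresentedGroup.of i : PresentedGroup R) = PresentedGroup.of 0 := by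
    intro i
    fin_cases i
    · rfl
    · exact h01.symm
    · exact (h01.trans h12).symm
  have h3 : (PresentedGroup.of 0 : PresentedGroup R) ^ (3 : ℤ) = 1 := by
    rw [← h12, ← h01] at h012
    have : (PresentedGroup.of 0 : PresentedGroup R) ^ 3 = 1 := by
      rw [pow_succ, pow_two]; exact h012
    exact_mod_cast this
  have hgen : ∀ g : PresentedGroup R, g ∈ Subgroup.zpowers (PresentedGroup.of 0) := by
    intro g
    have hle : Subgroup.closure (Set.range (PresentedGroup.of (rels := R)))
        ≤ Subgroup.zpowers (PresentedGroup.of 0) := by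
      rw [Subgroup.closure_le]
      rintro _ ⟨i, rfl⟩
      rw [hx i]
      exact Subgroup.mem_zpowers _
    rw [PresentedGroup.closure_range_of] at hle
    exact hle (Subgroup.mem_top g)
  refine ⟨MulEquiv.ofBijective (PresentedGroup.toGroup hf) ⟨?_, ?_⟩⟩
  · rw [injective_iff_map_eq_one]
    intro g hg
    obtain ⟨k, rfl⟩ := Subgroup.mem_zpowers_iff.mp (hgen g)
    rw [map_zpow, PresentedGroup.toGroup.of, ← ofAdd_zsmul, ofAdd_eq_one, zsmul_one,
      ZMod.intCast_zmod_eq_zero_iff_dvd] at hg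
    obtain ⟨m, hm⟩ := hg
    have hm' : k = 3 * m := by exact_mod_cast hm
    rw [hm', zpow_mul, h3, one_zpow]
  · intro y
    refine ⟨PresentedGroup.of 0 ^ (y.toAdd.val), ?_⟩
    rw [map_pow, PresentedGroup.toGroup.of]
    revert y
    decide
end

section
/- Let α be a type, R a set of elements of the free group on α, and w an element of the free group on α. Let ι : FreeGroup α →* FreeGroup (α ⊕ Unit) be the homomorphism induced by the inclusion of generators, and let x denote the generator of FreeGroup (α ⊕ Unit) corresponding to the element of Unit. Then the group presented over α ⊕ Unit by the relator set (ι '' R) ∪ {x · (ι w)⁻¹} is isomorphic to the group presented over α by the relator set R. -/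
open FreeGroup

/-- Tietze transformation: adding a new generator `x` (corresponding to the element of `Unit`)
together with a relator `x · (ι w)⁻¹` expressing `x` as a word `w` in the old generators
does not change the presented group. Here `ι : FreeGroup α →* FreeGroup (α ⊕ Unit)` is
induced by the inclusion of generators. -/
theorem presentedGroup_add_generator (α : Type*) (R : Set (FreeGroup α)) (w : FreeGroup α) :
    Nonempty
      (PresentedGroup
          (((FreeGroup.map (Sum.inl : α → α ⊕ Unit)) '' R) ∪
            {FreeGroup.of (Sum.inr ()) * ((FreeGroup.map (Sum.inl : α → α ⊕ Unit)) w)⁻¹}) ≃*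
        PresentedGroup R) := by
  set S : Set (FreeGroup (α ⊕ Unit)) :=
    ((FreeGroup.map (Sum.inl : α → α ⊕ Unit)) '' R) ∪
      {FreeGroup.of (Sum.inr ()) * ((FreeGroup.map (Sum.inl : α → α ⊕ Unit)) w)⁻¹} with hS
  let f : α ⊕ Unit → PresentedGroup R :=
    Sum.elim PresentedGroup.of (fun _ => PresentedGroup.mk R w)
  let g : α → PresentedGroup S := fun a => PresentedGroup.of (Sum.inl a)
  have hf : ∀ v : FreeGroup α,
      FreeGroup.lift f (FreeGroup.map Sum.inl v) = PresentedGroup.mk R v := by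
    have h : (FreeGroup.lift f).comp (FreeGroup.map Sum.inl) = PresentedGroup.mk R :=
      FreeGroup.ext_hom _ _ fun a => by simp [f, PresentedGroup.of]
    exact fun v => DFunLike.congr_fun h v
  have hg : ∀ v : FreeGroup α,
      FreeGroup.lift g v = PresentedGroup.mk S (FreeGroup.map Sum.inl v) := by
    have h : FreeGroup.lift g = (PresentedGroup.mk S).comp (FreeGroup.map Sum.inl) :=
      FreeGroup.ext_hom _ _ fun a => by simp [g, PresentedGroup.of]
    exact fun v => DFunLike.congr_fun h v
  have hfS : ∀ r ∈ S, FreeGroup.lift f r = 1 := by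
    rintro r (⟨v, hv, rfl⟩ | hr)
    · rw [hf]
      exact PresentedGroup.one_of_mem hv
    · rw [Set.mem_singleton_iff] at hr
      rw [hr, _root_.map_mul, _root_.map_inv, hf, FreeGroup.lift_apply_of]
      exact mul_inv_cancel _
  have hgR : ∀ r ∈ R, FreeGroup.lift g r = 1 := by
    intro r hr
    rw [hg]
    exact PresentedGroup.one_of_mem (Or.inl ⟨r, hr, rfl⟩)
  have hx : PresentedGroup.mk S (FreeGroup.map Sum.inl w) = PresentedGroup.of (Sum.inr ()) :=
    (PresentedGroup.mk_eq_mk_of_mul_inv_mem (Or.inr rfl)).symm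
  refine ⟨MonoidHom.toMulEquiv (PresentedGroup.toGroup hfS) (PresentedGroup.toGroup hgR) ?_ ?_⟩
  · apply PresentedGroup.ext
    rintro (a | ⟨⟩)
    · rw [MonoidHom.comp_apply, PresentedGroup.toGroup.of]
      exact PresentedGroup.toGroup.of hgR
    · rw [MonoidHom.comp_apply, PresentedGroup.toGroup.of]
      exact (hg w).trans hx
  · apply PresentedGroup.ext
    intro a
    rw [MonoidHom.comp_apply, PresentedGroup.toGroup.of]
    exact PresentedGroup.toGroup.of hfS
end

section
/- Let α be a type, let a, b : α, let R be a set of elements of the free group on α, and let r₁, r₂ ∈ R with r₁ ≠ r₂. Let ι : FreeGroup α →* FreeGroup (α ⊕ Unit) be induced by the inclusion of generators, write A = ι(of a), B = ι(of b), and let x be the generator corresponding to the element of Unit. Then the group presented over α ⊕ Unit by the relator set (ι '' (R \ {r₁, r₂})) ∪ { (ι r₁)·A⁻¹·x·A , (ι r₂)·B⁻¹·A⁻¹·x⁻¹·x·A·B , B⁻¹·x⁻¹·B } is isomorphic to the group presented over α by the relator set R. -/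
open FreeGroup

/-- The change of presentation effected by the first Reidemeister move `R₁ʳ`:
with `ι : FreeGroup α →* FreeGroup (α ⊕ Unit)` induced by the inclusion of generators,
`A = ι (of a)`, `B = ι (of b)`, and `x = of (Sum.inr ())` the new crossing generator,
the group presented over `α ⊕ Unit` by
`(ι '' (R \ {r₁, r₂})) ∪ {ι r₁ · A⁻¹ · x · A, ι r₂ · B⁻¹ · A⁻¹ · x⁻¹ · x · A · B, B⁻¹ · x⁻¹ · B}`
is isomorphic to the group presented over `α` by `R`. -/
theorem presentedGroup_reidemeister_one (α : Type*) (a b : α) (R : Set (FreeGroup α))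
    (r₁ r₂ : FreeGroup α) (hr₁ : r₁ ∈ R) (hr₂ : r₂ ∈ R) (hne : r₁ ≠ r₂) :
    letI ι : FreeGroup α →* FreeGroup (α ⊕ Unit) := FreeGroup.map Sum.inl
    letI A : FreeGroup (α ⊕ Unit) := ι (FreeGroup.of a)
    letI B : FreeGroup (α ⊕ Unit) := ι (FreeGroup.of b)
    letI x : FreeGroup (α ⊕ Unit) := FreeGroup.of (Sum.inr ())
    Nonempty
      (PresentedGroup
          ((ι '' (R \ {r₁, r₂})) ∪
            {ι r₁ * A⁻¹ * x * A,
             ι r₂ * B⁻¹ * A⁻¹ * x⁻¹ * x * A * B,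
             B⁻¹ * x⁻¹ * B}) ≃*
        PresentedGroup R) := by
  let ι : FreeGroup α →* FreeGroup (α ⊕ Unit) := FreeGroup.map Sum.inl
  let A : FreeGroup (α ⊕ Unit) := ι (FreeGroup.of a)
  let B : FreeGroup (α ⊕ Unit) := ι (FreeGroup.of b)
  let x : FreeGroup (α ⊕ Unit) := FreeGroup.of (Sum.inr ())
  let S : Set (FreeGroup (α ⊕ Unit)) := (ι '' (R \ {r₁, r₂})) ∪
            {ι r₁ * A⁻¹ * x * A,
             ι r₂ * B⁻¹ * A⁻¹ * x⁻¹ * x * A * B,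
             B⁻¹ * x⁻¹ * B}
  change Nonempty (PresentedGroup S ≃* PresentedGroup R)
  let f : α ⊕ Unit → PresentedGroup R := Sum.elim PresentedGroup.of (fun _ => 1)
  have hfι : ∀ w, FreeGroup.lift f (ι w) = PresentedGroup.mk R w := by
    intro w
    have : (FreeGroup.lift f).comp ι = PresentedGroup.mk R := by
      ext y
      simp [ι, f, PresentedGroup.of]
    exact DFunLike.congr_fun this w
  have hfx : FreeGroup.lift f x = 1 := by simp [x, f]
  have hf : ∀ r ∈ S, FreeGroup.lift f r = 1 := by
    rintro r (⟨w, hw, rfl⟩ | rfl | rfl | rfl)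
    · rw [hfι]; exact PresentedGroup.one_of_mem hw.1
    · simp only [_root_.map_mul, _root_.map_inv, hfx, hfι, PresentedGroup.one_of_mem hr₁]; group
    · simp only [_root_.map_mul, _root_.map_inv, hfx, A, B, hfι, PresentedGroup.one_of_mem hr₂]; group
    · simp only [_root_.map_mul, _root_.map_inv, hfx]; group
  have hx : PresentedGroup.mk S x = 1 := by
    have h : PresentedGroup.mk S (B⁻¹ * x⁻¹ * B) = 1 :=
      PresentedGroup.one_of_mem (by simp [S])
    simp only [_root_.map_mul, _root_.map_inv] at h
    have h2 := congrArg (fun t => PresentedGroup.mk S B * t * (PresentedGroup.mk S B)⁻¹) h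
    simpa [mul_assoc] using h2
  have h1 : PresentedGroup.mk S (ι r₁) = 1 := by
    have h : PresentedGroup.mk S (ι r₁ * A⁻¹ * x * A) = 1 :=
      PresentedGroup.one_of_mem (by simp [S])
    simpa only [_root_.map_mul, _root_.map_inv, hx, mul_one, inv_mul_cancel_right] using h
  have h2 : PresentedGroup.mk S (ι r₂) = 1 := by
    have h : PresentedGroup.mk S (ι r₂ * B⁻¹ * A⁻¹ * x⁻¹ * x * A * B) = 1 :=
      PresentedGroup.one_of_mem (by right; right; left; rfl)
    simpa only [_root_.map_mul, _root_.map_inv, hx, mul_one, inv_one, inv_mul_cancel_right] using h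
  let g : α → PresentedGroup S := fun y => PresentedGroup.of (Sum.inl y)
  have hgι : ∀ w, FreeGroup.lift g w = PresentedGroup.mk S (ι w) := by
    intro w
    have : FreeGroup.lift g = (PresentedGroup.mk S).comp ι := by
      ext y
      simp [ι, g, PresentedGroup.of]
    exact DFunLike.congr_fun this w
  have hg : ∀ r ∈ R, FreeGroup.lift g r = 1 := by
    intro r hr
    rw [hgι]
    by_cases e1 : r = r₁
    · rw [e1, h1]
    by_cases e2 : r = r₂
    · rw [e2, h2]
    exact PresentedGroup.one_of_mem (Or.inl ⟨r, ⟨hr, by simp [e1, e2]⟩, rfl⟩)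
  refine ⟨MonoidHom.toMulEquiv (PresentedGroup.toGroup hf) (PresentedGroup.toGroup hg) ?_ ?_⟩
  · apply PresentedGroup.ext
    rintro (y | ⟨⟩)
    · simp [f, g]
    · simp only [MonoidHom.comp_apply, PresentedGroup.toGroup.of, f, Sum.elim_inr, _root_.map_one,
        MonoidHom.id_apply]
      exact hx.symm
  · apply PresentedGroup.ext
    intro y
    simp [f, g]
end

section
/- Let α be a type, let a, b : α, let R be a set of elements of the free group on α, and let r₁, r₂, r₃ ∈ R be pairwise distinct, with r₂ = w₁·w₂ for elements w₁, w₂ of the free group on α. Let ι : FreeGroup α →* FreeGroup (α ⊕ Fin 2) be induced by the inclusion of generators, write A = ι(of a), B = ι(of b), and let x, y be the generators corresponding to the two elements of Fin 2. Then the group presented over α ⊕ Fin 2 by the relator set (ι '' (R \ {r₁, r₂, r₃})) ∪ { (ι r₁)·A⁻¹·x·A·A⁻¹·y⁻¹·A , (ι r₃)·B⁻¹·y·B·B⁻¹·x⁻¹·B , B⁻¹·A⁻¹·x⁻¹·y·A·B , (ι w₁)·x·A·B , (ι w₂)·B⁻¹·A⁻¹·y⁻¹ } is isomorphic to the group presented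 over α by the relator set R. -/
open FreeGroup

/-- The change of presentation effected by the second Reidemeister move `R₂`:
with `ι : FreeGroup α →* FreeGroup (α ⊕ Fin 2)` induced by the inclusion of generators,
`A = ι (of a)`, `B = ι (of b)`, and `x = of (Sum.inr 0)`, `y = of (Sum.inr 1)` the new
crossing generators, if `r₁, r₂, r₃ ∈ R` are pairwise distinct and `r₂ = w₁ · w₂`, then the
group presented over `α ⊕ Fin 2` by
`(ι '' (R \ {r₁, r₂, r₃})) ∪ {ι r₁ · A⁻¹xA · A⁻¹y⁻¹A, ι r₃ · B⁻¹yB · B⁻¹x⁻¹B,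
B⁻¹A⁻¹x⁻¹ · yAB, ι w₁ · xAB, ι w₂ · B⁻¹A⁻¹y⁻¹}` is isomorphic to the group presented
over `α` by `R`. -/
theorem presentedGroup_reidemeister_two (α : Type*) (a b : α) (R : Set (FreeGroup α))
    (r₁ r₂ r₃ w₁ w₂ : FreeGroup α) (hr₁ : r₁ ∈ R) (hr₂ : r₂ ∈ R) (hr₃ : r₃ ∈ R)
    (h12 : r₁ ≠ r₂) (h13 : r₁ ≠ r₃) (h23 : r₂ ≠ r₃) (hsplit : r₂ = w₁ * w₂) :
    letI ι : FreeGroup α →* FreeGroup (α ⊕ Fin 2) := FreeGroup.map Sum.inl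
    letI A : FreeGroup (α ⊕ Fin 2) := ι (FreeGroup.of a)
    letI B : FreeGroup (α ⊕ Fin 2) := ι (FreeGroup.of b)
    letI x : FreeGroup (α ⊕ Fin 2) := FreeGroup.of (Sum.inr 0)
    letI y : FreeGroup (α ⊕ Fin 2) := FreeGroup.of (Sum.inr 1)
    Nonempty
      (PresentedGroup
          ((ι '' (R \ {r₁, r₂, r₃})) ∪
            {ι r₁ * A⁻¹ * x * A * A⁻¹ * y⁻¹ * A,
             ι r₃ * B⁻¹ * y * B * B⁻¹ * x⁻¹ * B,
             B⁻¹ * A⁻¹ * x⁻¹ * y * A * B,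
             ι w₁ * x * A * B,
             ι w₂ * B⁻¹ * A⁻¹ * y⁻¹}) ≃*
        PresentedGroup R) := by
  let ι : FreeGroup α →* FreeGroup (α ⊕ Fin 2) := FreeGroup.map Sum.inl
  let A : FreeGroup (α ⊕ Fin 2) := ι (FreeGroup.of a)
  let B : FreeGroup (α ⊕ Fin 2) := ι (FreeGroup.of b)
  let x : FreeGroup (α ⊕ Fin 2) := FreeGroup.of (Sum.inr 0)
  let y : FreeGroup (α ⊕ Fin 2) := FreeGroup.of (Sum.inr 1)
  let S : Set (FreeGroup (α ⊕ Fin 2)) := (ι '' (R \ {r₁, r₂, r₃})) ∪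
            {ι r₁ * A⁻¹ * x * A * A⁻¹ * y⁻¹ * A,
             ι r₃ * B⁻¹ * y * B * B⁻¹ * x⁻¹ * B,
             B⁻¹ * A⁻¹ * x⁻¹ * y * A * B,
             ι w₁ * x * A * B,
             ι w₂ * B⁻¹ * A⁻¹ * y⁻¹}
  have hS : S = _ := rfl
  change Nonempty (PresentedGroup S ≃* PresentedGroup R)
  -- forward map
  let c : PresentedGroup R := PresentedGroup.mk R (w₁⁻¹ * (FreeGroup.of b)⁻¹ * (FreeGroup.of a)⁻¹)
  let f : α ⊕ Fin 2 → PresentedGroup R := Sum.elim PresentedGroup.of (fun _ => c)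
  have hfι : ∀ w, FreeGroup.lift f (ι w) = PresentedGroup.mk R w := by
    intro w
    have : (FreeGroup.lift f).comp ι = PresentedGroup.mk R :=
      FreeGroup.ext_hom _ _ fun _ => by simp [ι, f, PresentedGroup.of]
    exact DFunLike.congr_fun this w
  have hfx : FreeGroup.lift f x = c := by simp [x, f]
  have hfy : FreeGroup.lift f y = c := by simp [y, f]
  have e1 : PresentedGroup.mk R r₁ = 1 := PresentedGroup.one_of_mem hr₁
  have e3 : PresentedGroup.mk R r₃ = 1 := PresentedGroup.one_of_mem hr₃
  have e2 : PresentedGroup.mk R w₁ * PresentedGroup.mk R w₂ = 1 := by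
    rw [← _root_.map_mul, ← hsplit]; exact PresentedGroup.one_of_mem hr₂
  have e2' : PresentedGroup.mk R w₂ = (PresentedGroup.mk R w₁)⁻¹ :=
    (inv_eq_of_mul_eq_one_right e2).symm
  have hf : ∀ r ∈ S, FreeGroup.lift f r = 1 := by
    intro r hr
    rcases hr with ⟨s, hs, rfl⟩ | rfl | rfl | rfl | rfl | rfl
    · rw [hfι]; exact PresentedGroup.one_of_mem hs.1
    · simp only [_root_.map_mul, _root_.map_inv, hfι, hfx, hfy, A, B, e1]; group
    · simp only [_root_.map_mul, _root_.map_inv, hfι, hfx, hfy, A, B, e3]; group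
    · simp only [_root_.map_mul, _root_.map_inv, hfι, hfx, hfy, A, B]; group
    · simp only [_root_.map_mul, _root_.map_inv, hfι, hfx, hfy, A, B, c]; group
    · simp only [_root_.map_mul, _root_.map_inv, hfι, hfx, hfy, A, B, c, e2']; group
  -- relations in the target
  have q1 := PresentedGroup.one_of_mem (rels := S)
    (x := ι r₁ * A⁻¹ * x * A * A⁻¹ * y⁻¹ * A) (Or.inr (by simp))
  have q2 := PresentedGroup.one_of_mem (rels := S)
    (x := ι r₃ * B⁻¹ * y * B * B⁻¹ * x⁻¹ * B) (Or.inr (by simp))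
  have q3 := PresentedGroup.one_of_mem (rels := S)
    (x := B⁻¹ * A⁻¹ * x⁻¹ * y * A * B) (Or.inr (by simp))
  have q4 := PresentedGroup.one_of_mem (rels := S)
    (x := ι w₁ * x * A * B) (Or.inr (by simp))
  have q5 := PresentedGroup.one_of_mem (rels := S)
    (x := ι w₂ * B⁻¹ * A⁻¹ * y⁻¹) (Or.inr (by simp))
  simp only [_root_.map_mul, _root_.map_inv] at q1 q2 q3 q4 q5
  have hxy : PresentedGroup.mk S y = PresentedGroup.mk S x := by
    generalize PresentedGroup.mk S A = A' at *
    generalize PresentedGroup.mk S B = B' at *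
    generalize PresentedGroup.mk S x = x' at *
    generalize PresentedGroup.mk S y = y' at *
    have : x'⁻¹ * y' = (A' * B') * (B'⁻¹ * A'⁻¹ * x'⁻¹ * y' * A' * B') * (A' * B')⁻¹ := by group
    rw [q3] at this
    have h : x'⁻¹ * y' = 1 := by rw [this]; group
    exact (inv_mul_eq_one.mp h).symm
  rw [hxy] at q1 q2 q5
  have p1 : PresentedGroup.mk S (ι r₁) = 1 := by
    rw [← q1]; group
  have p3 : PresentedGroup.mk S (ι r₃) = 1 := by
    rw [← q2]; group
  have px : PresentedGroup.mk S x = (PresentedGroup.mk S (ι w₁))⁻¹ *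
      (PresentedGroup.mk S B)⁻¹ * (PresentedGroup.mk S A)⁻¹ := by
    rw [mul_assoc, mul_assoc] at q4
    have h := eq_inv_of_mul_eq_one_right q4
    rw [← h]; group
  have p2 : PresentedGroup.mk S (ι r₂) = 1 := by
    rw [hsplit, _root_.map_mul, _root_.map_mul]
    rw [px] at q5
    have h : PresentedGroup.mk S (ι w₂) * PresentedGroup.mk S (ι w₁) = 1 := by
      rw [← q5]; group
    exact mul_eq_one_comm.mp h
  let g : α → PresentedGroup S := fun i => PresentedGroup.of (Sum.inl i)
  have hgι : ∀ w, FreeGroup.lift g w = PresentedGroup.mk S (ι w) := by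
    intro w
    have : FreeGroup.lift g = (PresentedGroup.mk S).comp ι :=
      FreeGroup.ext_hom _ _ fun _ => by simp [ι, g, PresentedGroup.of]
    exact DFunLike.congr_fun this w
  have hg : ∀ r ∈ R, FreeGroup.lift g r = 1 := by
    intro r hr
    rw [hgι]
    by_cases k1 : r = r₁
    · rw [k1, p1]
    by_cases k2 : r = r₂
    · rw [k2, p2]
    by_cases k3 : r = r₃
    · rw [k3, p3]
    exact PresentedGroup.one_of_mem (Or.inl ⟨r, ⟨hr, by simp [k1, k2, k3]⟩, rfl⟩)
  have hgc : PresentedGroup.toGroup hg c = PresentedGroup.mk S x := by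
    have : PresentedGroup.toGroup hg c =
      FreeGroup.lift g (w₁⁻¹ * (FreeGroup.of b)⁻¹ * (FreeGroup.of a)⁻¹) := rfl
    rw [this, hgι, px]
    simp only [_root_.map_mul, _root_.map_inv, A, B]
  refine ⟨MonoidHom.toMulEquiv (PresentedGroup.toGroup hf) (PresentedGroup.toGroup hg) ?_ ?_⟩
  · refine PresentedGroup.ext ?_
    rintro (i | i)
    · simp [f, g]
    · have : PresentedGroup.of (rels := S) (Sum.inr i) = PresentedGroup.mk S x := by
        fin_cases i
        · rfl
        · exact hxy
      rw [MonoidHom.comp_apply, PresentedGroup.toGroup.of]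
      exact hgc.trans this.symm
  · refine PresentedGroup.ext fun i => ?_
    simp [f, g]
end

section
/- Let α be a type, let a, b : α, let w₁, …, w₆ be elements of the free group on α, and let R be a set of elements of the free group on α. Let ι : FreeGroup α →* FreeGroup (α ⊕ Fin 3) be induced by the inclusion of generators, write A = ι(of a), B = ι(of b), and let x₁, x₂, x₃ (respectively y₁, y₂, y₃) be the generators corresponding to the three elements of Fin 3. Then the group presented over α ⊕ Fin 3 by the relator set (ι '' R) ∪ { B⁻¹A⁻¹x₃⁻¹·x₁AB·(ι w₁), A⁻¹x₃A·(ι w₂), B⁻¹A⁻¹x₂⁻¹·x₃AB·(ι w₃), A⁻¹x₂A·(ι w₄), B⁻¹A⁻¹x₁⁻¹·x₂AB·(ι w₅), A⁻¹x₁⁻¹A·(ι w₆), B⁻¹x₁B·B⁻¹x₃⁻¹B·B⁻¹x₂⁻¹B } is isomorphic to the group presented over α ⊕ Fin 3 by the relator set (ι '' R) ∪ { B⁻¹y₃⁻¹B·(ι w₁), y₁AB·B⁻¹A⁻¹y₃⁻¹·(ι w₂), B⁻¹y₁B·(ι w₃), y₂AB·B⁻¹A⁻¹y₁⁻¹·(ι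 w₄), B⁻¹y₂⁻¹B·(ι w₅), y₃AB·B⁻¹A⁻¹y₂⁻¹·(ι w₆), A⁻¹y₃A·A⁻¹y₁⁻¹A·A⁻¹y₂A }, an isomorphism being induced by the substitution y₁ = A⁻¹x₂⁻¹x₃A, y₂ = A⁻¹x₂⁻¹x₁A, y₃ = A⁻¹x₁⁻¹x₃A fixing all generators from α. -/
open FreeGroup

set_option linter.unusedSimpArgs false

theorem r3_aux {X : Type*} (S₁ S₂ : Set (FreeGroup X)) (σ τ : FreeGroup X →* FreeGroup X)
    (h₁ : ∀ r ∈ S₂, PresentedGroup.mk S₁ (σ r) = 1)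
    (h₂ : ∀ r ∈ S₁, PresentedGroup.mk S₂ (τ r) = 1)
    (h₃ : ∀ s, PresentedGroup.mk S₁ (σ (τ (FreeGroup.of s))) = PresentedGroup.mk S₁ (FreeGroup.of s))
    (h₄ : ∀ s, PresentedGroup.mk S₂ (τ (σ (FreeGroup.of s))) = PresentedGroup.mk S₂ (FreeGroup.of s)) :
    ∃ e : PresentedGroup S₂ ≃* PresentedGroup S₁,
      ∀ w, e (PresentedGroup.mk S₂ w) = PresentedGroup.mk S₁ (σ w) := by
  let F : PresentedGroup S₂ →* PresentedGroup S₁ :=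
    QuotientGroup.lift _ ((PresentedGroup.mk S₁).comp σ)
      (Subgroup.normalClosure_le_normal (N := ((PresentedGroup.mk S₁).comp σ).ker) h₁)
  let G : PresentedGroup S₁ →* PresentedGroup S₂ :=
    QuotientGroup.lift _ ((PresentedGroup.mk S₂).comp τ)
      (Subgroup.normalClosure_le_normal (N := ((PresentedGroup.mk S₂).comp τ).ker) h₂)
  have hF : ∀ w, F (PresentedGroup.mk S₂ w) = PresentedGroup.mk S₁ (σ w) := fun _ => rfl
  have hG : ∀ w, G (PresentedGroup.mk S₁ w) = PresentedGroup.mk S₂ (τ w) := fun _ => rfl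
  refine ⟨MonoidHom.toMulEquiv F G ?_ ?_, hF⟩
  · ext s
    exact h₄ s
  · ext s
    exact h₃ s

/-- The change of presentation effected by the third Reidemeister move `R₃`:
with `ι : FreeGroup α →* FreeGroup (α ⊕ Fin 3)` induced by the inclusion of generators,
`A = ι (of a)`, `B = ι (of b)`, and `x₁, x₂, x₃` (resp. `y₁, y₂, y₃`) the generators
`of (Sum.inr 0), of (Sum.inr 1), of (Sum.inr 2)`, the two presented groups below are
isomorphic, an isomorphism being induced by the substitution
`y₁ = A⁻¹x₂⁻¹x₃A`, `y₂ = A⁻¹x₂⁻¹x₁A`, `y₃ = A⁻¹x₁⁻¹x₃A` fixing all generators from `α`. -/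
theorem presentedGroup_reidemeister_three (α : Type*) (a b : α)
    (w₁ w₂ w₃ w₄ w₅ w₆ : FreeGroup α) (R : Set (FreeGroup α)) :
    letI ι : FreeGroup α →* FreeGroup (α ⊕ Fin 3) := FreeGroup.map Sum.inl
    letI A : FreeGroup (α ⊕ Fin 3) := ι (FreeGroup.of a)
    letI B : FreeGroup (α ⊕ Fin 3) := ι (FreeGroup.of b)
    letI x₁ : FreeGroup (α ⊕ Fin 3) := FreeGroup.of (Sum.inr 0)
    letI x₂ : FreeGroup (α ⊕ Fin 3) := FreeGroup.of (Sum.inr 1)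
    letI x₃ : FreeGroup (α ⊕ Fin 3) := FreeGroup.of (Sum.inr 2)
    letI y₁ : FreeGroup (α ⊕ Fin 3) := FreeGroup.of (Sum.inr 0)
    letI y₂ : FreeGroup (α ⊕ Fin 3) := FreeGroup.of (Sum.inr 1)
    letI y₃ : FreeGroup (α ⊕ Fin 3) := FreeGroup.of (Sum.inr 2)
    letI S₁ : Set (FreeGroup (α ⊕ Fin 3)) :=
      (ι '' R) ∪
        {B⁻¹ * A⁻¹ * x₃⁻¹ * (x₁ * A * B) * ι w₁,
         A⁻¹ * x₃ * A * ι w₂,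
         B⁻¹ * A⁻¹ * x₂⁻¹ * (x₃ * A * B) * ι w₃,
         A⁻¹ * x₂ * A * ι w₄,
         B⁻¹ * A⁻¹ * x₁⁻¹ * (x₂ * A * B) * ι w₅,
         A⁻¹ * x₁⁻¹ * A * ι w₆,
         B⁻¹ * x₁ * B * (B⁻¹ * x₃⁻¹ * B) * (B⁻¹ * x₂⁻¹ * B)}
    letI S₂ : Set (FreeGroup (α ⊕ Fin 3)) :=
      (ι '' R) ∪
        {B⁻¹ * y₃⁻¹ * B * ι w₁,
         y₁ * A * B * (B⁻¹ * A⁻¹ * y₃⁻¹) * ι w₂,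
         B⁻¹ * y₁ * B * ι w₃,
         y₂ * A * B * (B⁻¹ * A⁻¹ * y₁⁻¹) * ι w₄,
         B⁻¹ * y₂⁻¹ * B * ι w₅,
         y₃ * A * B * (B⁻¹ * A⁻¹ * y₂⁻¹) * ι w₆,
         A⁻¹ * y₃ * A * (A⁻¹ * y₁⁻¹ * A) * (A⁻¹ * y₂ * A)}
    letI σ : FreeGroup (α ⊕ Fin 3) →* FreeGroup (α ⊕ Fin 3) :=
      FreeGroup.lift
        (Sum.elim (fun a' => FreeGroup.of (Sum.inl a'))
          ![A⁻¹ * x₂⁻¹ * x₃ * A, A⁻¹ * x₂⁻¹ * x₁ * A, A⁻¹ * x₁⁻¹ * x₃ * A])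
    ∃ e : PresentedGroup S₂ ≃* PresentedGroup S₁,
      ∀ w : FreeGroup (α ⊕ Fin 3),
        e (PresentedGroup.mk S₂ w) = PresentedGroup.mk S₁ (σ w) := by
  let ι : FreeGroup α →* FreeGroup (α ⊕ Fin 3) := FreeGroup.map Sum.inl
  let A : FreeGroup (α ⊕ Fin 3) := ι (FreeGroup.of a)
  let B : FreeGroup (α ⊕ Fin 3) := ι (FreeGroup.of b)
  let x₁ : FreeGroup (α ⊕ Fin 3) := FreeGroup.of (Sum.inr 0)
  let x₂ : FreeGroup (α ⊕ Fin 3) := FreeGroup.of (Sum.inr 1)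
  let x₃ : FreeGroup (α ⊕ Fin 3) := FreeGroup.of (Sum.inr 2)
  let y₁ : FreeGroup (α ⊕ Fin 3) := FreeGroup.of (Sum.inr 0)
  let y₂ : FreeGroup (α ⊕ Fin 3) := FreeGroup.of (Sum.inr 1)
  let y₃ : FreeGroup (α ⊕ Fin 3) := FreeGroup.of (Sum.inr 2)
  let S₁ : Set (FreeGroup (α ⊕ Fin 3)) :=
      (ι '' R) ∪
        {B⁻¹ * A⁻¹ * x₃⁻¹ * (x₁ * A * B) * ι w₁,
         A⁻¹ * x₃ * A * ι w₂,
         B⁻¹ * A⁻¹ * x₂⁻¹ * (x₃ * A * B) * ι w₃,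
         A⁻¹ * x₂ * A * ι w₄,
         B⁻¹ * A⁻¹ * x₁⁻¹ * (x₂ * A * B) * ι w₅,
         A⁻¹ * x₁⁻¹ * A * ι w₆,
         B⁻¹ * x₁ * B * (B⁻¹ * x₃⁻¹ * B) * (B⁻¹ * x₂⁻¹ * B)}
  let S₂ : Set (FreeGroup (α ⊕ Fin 3)) :=
      (ι '' R) ∪
        {B⁻¹ * y₃⁻¹ * B * ι w₁,
         y₁ * A * B * (B⁻¹ * A⁻¹ * y₃⁻¹) * ι w₂,
         B⁻¹ * y₁ * B * ι w₃,
         y₂ * A * B * (B⁻¹ * A⁻¹ * y₁⁻¹) * ι w₄,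
         B⁻¹ * y₂⁻¹ * B * ι w₅,
         y₃ * A * B * (B⁻¹ * A⁻¹ * y₂⁻¹) * ι w₆,
         A⁻¹ * y₃ * A * (A⁻¹ * y₁⁻¹ * A) * (A⁻¹ * y₂ * A)}
  let σ : FreeGroup (α ⊕ Fin 3) →* FreeGroup (α ⊕ Fin 3) :=
      FreeGroup.lift
        (Sum.elim (fun a' => FreeGroup.of (Sum.inl a'))
          ![A⁻¹ * x₂⁻¹ * x₃ * A, A⁻¹ * x₂⁻¹ * x₁ * A, A⁻¹ * x₁⁻¹ * x₃ * A])
  let τ : FreeGroup (α ⊕ Fin 3) →* FreeGroup (α ⊕ Fin 3) :=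
      FreeGroup.lift
        (Sum.elim (fun a' => FreeGroup.of (Sum.inl a'))
          ![A * y₂ * y₃⁻¹ * A⁻¹, A * y₂ * y₁⁻¹ * A⁻¹, A * y₁ * y₃⁻¹ * A⁻¹])
  have hσι : ∀ w, σ (ι w) = ι w := by
    intro w
    have : σ.comp ι = ι := by ext s; simp [σ, ι]
    exact DFunLike.congr_fun this w
  have hτι : ∀ w, τ (ι w) = ι w := by
    intro w
    have : τ.comp ι = ι := by ext s; simp [τ, ι]
    exact DFunLike.congr_fun this w
  have σA : σ A = A := hσι _
  have σB : σ B = B := hσι _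
  have τA : τ A = A := hτι _
  have τB : τ B = B := hτι _
  have σ1 : σ y₁ = A⁻¹ * x₂⁻¹ * x₃ * A := by simp [σ, y₁]
  have σ2 : σ y₂ = A⁻¹ * x₂⁻¹ * x₁ * A := by simp [σ, y₂]
  have σ3 : σ y₃ = A⁻¹ * x₁⁻¹ * x₃ * A := by simp [σ, y₃]
  have τ1 : τ x₁ = A * y₂ * y₃⁻¹ * A⁻¹ := by simp [τ, x₁]
  have τ2 : τ x₂ = A * y₂ * y₁⁻¹ * A⁻¹ := by simp [τ, x₂]
  have τ3 : τ x₃ = A * y₁ * y₃⁻¹ * A⁻¹ := by simp [τ, x₃]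
  have m₁ : ∀ r ∈ S₁, PresentedGroup.mk S₁ r = 1 := fun r hr =>
    PresentedGroup.one_of_mem hr
  have m₂ : ∀ r ∈ S₂, PresentedGroup.mk S₂ r = 1 := fun r hr =>
    PresentedGroup.one_of_mem hr
  have k₁ : PresentedGroup.mk S₁ x₁ = PresentedGroup.mk S₁ x₂ * PresentedGroup.mk S₁ x₃ := by
    have h := m₁ (B⁻¹ * x₁ * B * (B⁻¹ * x₃⁻¹ * B) * (B⁻¹ * x₂⁻¹ * B)) (by simp [S₁])
    have h' := congrArg (fun g => PresentedGroup.mk S₁ B * g * (PresentedGroup.mk S₁ B)⁻¹) h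
    simp only [_root_.map_mul, _root_.map_inv] at h'
    simp only [mul_assoc, mul_inv_cancel_left, inv_mul_cancel_left, mul_inv_cancel, mul_one, one_mul] at h'
    rw [← mul_inv_rev] at h'
    exact mul_inv_eq_one.mp h'
  have k₂ : PresentedGroup.mk S₂ y₁ = PresentedGroup.mk S₂ y₂ * PresentedGroup.mk S₂ y₃ := by
    have h := m₂ (A⁻¹ * y₃ * A * (A⁻¹ * y₁⁻¹ * A) * (A⁻¹ * y₂ * A)) (by simp [S₂])
    have h' := congrArg (fun g => PresentedGroup.mk S₂ A * g * (PresentedGroup.mk S₂ A)⁻¹) h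
    simp only [_root_.map_mul, _root_.map_inv] at h'
    simp only [mul_assoc, mul_inv_cancel_left, inv_mul_cancel_left, mul_inv_cancel, mul_one, one_mul] at h'
    have h2 := mul_eq_one_iff_eq_inv.mp h'
    rw [h2]
    simp
  refine r3_aux S₁ S₂ σ τ ?_ ?_ ?_ ?_
  · rintro r (⟨r, hr, rfl⟩ | rfl | rfl | rfl | rfl | rfl | rfl | rfl)
    · rw [hσι]; exact m₁ _ (Or.inl ⟨r, hr, rfl⟩)
    · rw [← m₁ (B⁻¹ * A⁻¹ * x₃⁻¹ * (x₁ * A * B) * ι w₁) (by simp [S₁])]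
      simp only [_root_.map_mul, _root_.map_inv, hσι, σA, σB, σ1, σ2, σ3, k₁]
      group
    · rw [← m₁ (A⁻¹ * x₃ * A * ι w₂) (by simp [S₁])]
      simp only [_root_.map_mul, _root_.map_inv, hσι, σA, σB, σ1, σ2, σ3, k₁]
      group
    · rw [← m₁ (B⁻¹ * A⁻¹ * x₂⁻¹ * (x₃ * A * B) * ι w₃) (by simp [S₁])]
      simp only [_root_.map_mul, _root_.map_inv, hσι, σA, σB, σ1, σ2, σ3, k₁]
      group
    · rw [← m₁ (A⁻¹ * x₂ * A * ι w₄) (by simp [S₁])]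
      simp only [_root_.map_mul, _root_.map_inv, hσι, σA, σB, σ1, σ2, σ3, k₁]
      group
    · rw [← m₁ (B⁻¹ * A⁻¹ * x₁⁻¹ * (x₂ * A * B) * ι w₅) (by simp [S₁])]
      simp only [_root_.map_mul, _root_.map_inv, hσι, σA, σB, σ1, σ2, σ3, k₁]
      group
    · rw [← m₁ (A⁻¹ * x₁⁻¹ * A * ι w₆) (by simp [S₁])]
      simp only [_root_.map_mul, _root_.map_inv, hσι, σA, σB, σ1, σ2, σ3, k₁]
      group
    · simp only [_root_.map_mul, _root_.map_inv, hσι, σA, σB, σ1, σ2, σ3, k₁]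
      group
  · rintro r (⟨r, hr, rfl⟩ | rfl | rfl | rfl | rfl | rfl | rfl | rfl)
    · rw [hτι]; exact m₂ _ (Or.inl ⟨r, hr, rfl⟩)
    · rw [← m₂ (B⁻¹ * y₃⁻¹ * B * ι w₁) (by simp [S₂])]
      simp only [_root_.map_mul, _root_.map_inv, hτι, τA, τB, τ1, τ2, τ3, k₂]
      group
    · rw [← m₂ (y₁ * A * B * (B⁻¹ * A⁻¹ * y₃⁻¹) * ι w₂) (by simp [S₂])]
      simp only [_root_.map_mul, _root_.map_inv, hτι, τA, τB, τ1, τ2, τ3, k₂]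
      group
    · rw [← m₂ (B⁻¹ * y₁ * B * ι w₃) (by simp [S₂])]
      simp only [_root_.map_mul, _root_.map_inv, hτι, τA, τB, τ1, τ2, τ3, k₂]
      group
    · rw [← m₂ (y₂ * A * B * (B⁻¹ * A⁻¹ * y₁⁻¹) * ι w₄) (by simp [S₂])]
      simp only [_root_.map_mul, _root_.map_inv, hτι, τA, τB, τ1, τ2, τ3, k₂]
      group
    · rw [← m₂ (B⁻¹ * y₂⁻¹ * B * ι w₅) (by simp [S₂])]
      simp only [_root_.map_mul, _root_.map_inv, hτι, τA, τB, τ1, τ2, τ3, k₂]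
      group
    · rw [← m₂ (y₃ * A * B * (B⁻¹ * A⁻¹ * y₂⁻¹) * ι w₆) (by simp [S₂])]
      simp only [_root_.map_mul, _root_.map_inv, hτι, τA, τB, τ1, τ2, τ3, k₂]
      group
    · simp only [_root_.map_mul, _root_.map_inv, hτι, τA, τB, τ1, τ2, τ3, k₂]
      group
  · rintro (s | s)
    · have h : FreeGroup.of (Sum.inl s) = ι (FreeGroup.of s) := by simp [ι]
      rw [h, hτι, hσι]
    · fin_cases s
      · change PresentedGroup.mk S₁ (σ (τ x₁)) = PresentedGroup.mk S₁ x₁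
        rw [τ1]
        simp only [_root_.map_mul, _root_.map_inv, hσι, σA, σB, σ1, σ2, σ3, k₁]
        group
      · change PresentedGroup.mk S₁ (σ (τ x₂)) = PresentedGroup.mk S₁ x₂
        rw [τ2]
        simp only [_root_.map_mul, _root_.map_inv, hσι, σA, σB, σ1, σ2, σ3, k₁]
        group
      · change PresentedGroup.mk S₁ (σ (τ x₃)) = PresentedGroup.mk S₁ x₃
        rw [τ3]
        simp only [_root_.map_mul, _root_.map_inv, hσι, σA, σB, σ1, σ2, σ3, k₁]
        group
  · rintro (s | s)
    · have h : FreeGroup.of (Sum.inl s) = ι (FreeGroup.of s) := by simp [ι]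
      rw [h, hσι, hτι]
    · fin_cases s
      · change PresentedGroup.mk S₂ (τ (σ y₁)) = PresentedGroup.mk S₂ y₁
        rw [σ1]
        simp only [_root_.map_mul, _root_.map_inv, hτι, τA, τB, τ1, τ2, τ3, k₂]
        group
      · change PresentedGroup.mk S₂ (τ (σ y₂)) = PresentedGroup.mk S₂ y₂
        rw [σ2]
        simp only [_root_.map_mul, _root_.map_inv, hτι, τA, τB, τ1, τ2, τ3, k₂]
        group
      · change PresentedGroup.mk S₂ (τ (σ y₃)) = PresentedGroup.mk S₂ y₃
        rw [σ3]
        simp only [_root_.map_mul, _root_.map_inv, hτι, τA, τB, τ1, τ2, τ3, k₂]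
        group
end

section
/- Let G be a group and let α, β, u₁, u₂, u₃, u₄, u₅, u₆ ∈ G. Suppose s₁, s₂, s₃ ∈ G satisfy the seven equations: β⁻¹α⁻¹s₃⁻¹·s₁αβ·u₁ = 1; α⁻¹s₃α·u₂ = 1; β⁻¹α⁻¹s₂⁻¹·s₃αβ·u₃ = 1; α⁻¹s₂α·u₄ = 1; β⁻¹α⁻¹s₁⁻¹·s₂αβ·u₅ = 1; α⁻¹s₁⁻¹α·u₆ = 1; and β⁻¹s₁β·β⁻¹s₃⁻¹β·β⁻¹s₂⁻¹β = 1. Then there exist unique t₁, t₂, t₃ ∈ G satisfying the seven equations: β⁻¹t₃⁻¹β·u₁ = 1; t₁αβ·β⁻¹α⁻¹t₃⁻¹·u₂ = 1; β⁻¹t₁β·u₃ = 1; t₂αβ·β⁻¹α⁻¹t₁⁻¹·u₄ = 1; β⁻¹t₂⁻¹β·u₅ = 1; t₃αβ·β⁻¹α⁻¹t₂⁻¹·u₆ = 1; and α⁻¹t₃α·α⁻¹t₁⁻¹α·α⁻¹t₂α = 1. Moreover these unique values are t₁ = α⁻¹s₂⁻¹s₃α, t₂ = α⁻¹s₂⁻¹s₁α,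 and t₃ = α⁻¹s₁⁻¹s₃α. -/
/-- The third-Reidemeister-move colouring computation: if the colours `s₁, s₂, s₃` of the
three crossings satisfy the seven area equations before the move, then there exist unique
colours `t₁, t₂, t₃` satisfying the seven area equations after the move, and they are
`t₁ = α⁻¹s₂⁻¹s₃α`, `t₂ = α⁻¹s₂⁻¹s₁α`, `t₃ = α⁻¹s₁⁻¹s₃α`. -/
theorem colouring_reidemeister_three {G : Type*} [Group G]
    (α β u₁ u₂ u₃ u₄ u₅ u₆ s₁ s₂ s₃ : G)
    (h₁ : β⁻¹ * α⁻¹ * s₃⁻¹ * (s₁ * α * β) * u₁ = 1)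
    (h₂ : α⁻¹ * s₃ * α * u₂ = 1)
    (h₃ : β⁻¹ * α⁻¹ * s₂⁻¹ * (s₃ * α * β) * u₃ = 1)
    (h₄ : α⁻¹ * s₂ * α * u₄ = 1)
    (h₅ : β⁻¹ * α⁻¹ * s₁⁻¹ * (s₂ * α * β) * u₅ = 1)
    (h₆ : α⁻¹ * s₁⁻¹ * α * u₆ = 1)
    (h₇ : β⁻¹ * s₁ * β * (β⁻¹ * s₃⁻¹ * β) * (β⁻¹ * s₂⁻¹ * β) = 1) :
    (∃! t : G × G × G,
        β⁻¹ * t.2.2⁻¹ * β * u₁ = 1 ∧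
        t.1 * α * β * (β⁻¹ * α⁻¹ * t.2.2⁻¹) * u₂ = 1 ∧
        β⁻¹ * t.1 * β * u₃ = 1 ∧
        t.2.1 * α * β * (β⁻¹ * α⁻¹ * t.1⁻¹) * u₄ = 1 ∧
        β⁻¹ * t.2.1⁻¹ * β * u₅ = 1 ∧
        t.2.2 * α * β * (β⁻¹ * α⁻¹ * t.2.1⁻¹) * u₆ = 1 ∧
        α⁻¹ * t.2.2 * α * (α⁻¹ * t.1⁻¹ * α) * (α⁻¹ * t.2.1 * α) = 1) ∧
    (∀ t : G × G × G,
        (β⁻¹ * t.2.2⁻¹ * β * u₁ = 1 ∧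
        t.1 * α * β * (β⁻¹ * α⁻¹ * t.2.2⁻¹) * u₂ = 1 ∧
        β⁻¹ * t.1 * β * u₃ = 1 ∧
        t.2.1 * α * β * (β⁻¹ * α⁻¹ * t.1⁻¹) * u₄ = 1 ∧
        β⁻¹ * t.2.1⁻¹ * β * u₅ = 1 ∧
        t.2.2 * α * β * (β⁻¹ * α⁻¹ * t.2.1⁻¹) * u₆ = 1 ∧
        α⁻¹ * t.2.2 * α * (α⁻¹ * t.1⁻¹ * α) * (α⁻¹ * t.2.1 * α) = 1) →
        t = (α⁻¹ * s₂⁻¹ * s₃ * α, α⁻¹ * s₂⁻¹ * s₁ * α, α⁻¹ * s₁⁻¹ * s₃ * α)) := by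
  have e₇ : s₁ = s₂ * s₃ := by
    have h : β⁻¹ * (s₁ * (s₂ * s₃)⁻¹) * β = 1 := by
      rw [← h₇]; group
    have h' : s₁ * (s₂ * s₃)⁻¹ = 1 := by
      have := congrArg (fun x => β * x * β⁻¹) h
      simpa [mul_assoc] using this
    exact mul_inv_eq_one.mp h'
  have e₁ := eq_inv_of_mul_eq_one_right h₁
  have e₂ := eq_inv_of_mul_eq_one_right h₂
  have e₃ := eq_inv_of_mul_eq_one_right h₃
  have e₄ := eq_inv_of_mul_eq_one_right h₄
  have e₅ := eq_inv_of_mul_eq_one_right h₅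
  have e₆ := eq_inv_of_mul_eq_one_right h₆
  clear h₁ h₂ h₃ h₄ h₅ h₆ h₇
  subst e₁ e₂ e₃ e₄ e₅ e₆ e₇
  have key : ∀ t : G × G × G,
      β⁻¹ * t.2.2⁻¹ * β * (β⁻¹ * α⁻¹ * s₃⁻¹ * (s₂ * s₃ * α * β))⁻¹ = 1 →
      β⁻¹ * t.1 * β * (β⁻¹ * α⁻¹ * s₂⁻¹ * (s₃ * α * β))⁻¹ = 1 →
      β⁻¹ * t.2.1⁻¹ * β * (β⁻¹ * α⁻¹ * (s₂ * s₃)⁻¹ * (s₂ * α * β))⁻¹ = 1 →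
      t = (α⁻¹ * s₂⁻¹ * s₃ * α, α⁻¹ * s₂⁻¹ * (s₂ * s₃) * α,
        α⁻¹ * (s₂ * s₃)⁻¹ * s₃ * α) := by
    rintro ⟨t₁, t₂, t₃⟩ a b c
    have a' := mul_inv_eq_one.mp a
    have b' := mul_inv_eq_one.mp b
    have c' := mul_inv_eq_one.mp c
    have a2 := congrArg (fun x => (β * x * β⁻¹)⁻¹) a'
    have b2 := congrArg (fun x => β * x * β⁻¹) b'
    have c2 := congrArg (fun x => (β * x * β⁻¹)⁻¹) c'
    simp [mul_assoc] at a2 b2 c2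
    simp [mul_assoc, a2, b2, c2]
  refine ⟨⟨_, ?_, fun t ht => key t ht.1 ht.2.2.1 ht.2.2.2.2.1⟩,
    fun t ht => key t ht.1 ht.2.2.1 ht.2.2.2.2.1⟩
  refine ⟨?_, ?_, ?_, ?_, ?_, ?_, ?_⟩ <;> simp [mul_assoc]
end
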